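/- arXiv:2308.00190 — 4 statements merged into one kernel-verified Lean document; each statement's English description precedes it below -/
import Mathlib

section
/- Let f : ℝⁿ → ℝ be differentiable and let β ≥ 1. Suppose that for all y, z in the level set L = {y : f(y) ≤ f(x₁)} the quadratic upper bound f(z) ≤ f(y) + ⟨∇f(y), z − y⟩ + (β/2)‖z − y‖² holds (f is β-smooth over L). Define iterates by: η̄₁ = 1; g_t = ∇f(x_t); v_t = −g_t; P_t(η) = f(x_t) − η‖g_t‖² + (β/2) η² ‖g_t‖²; η_t = min(1/β, η̄_t) (the minimizer of P_t over [0, η̄_t] when g_t ≠ 0); x_{t+1} = x_t + η_t v_t; and η̄_{t+1} = 2η̄_t if η_t ≥ η̄_t/2, else η̄_{t+1} = η̄_t/2. Then for every T ≥ 1, min_{1 ≤ t ≤ T} ‖∇f(x_t)‖² ≤ 2β (f(x₁) − f(x_{T+1})) / T. -/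
open scoped RealInnerProductSpace

/-- If `f` is differentiable at `x` with nonzero gradient, then it decreases for small positive
steps along the negative gradient. -/
theorem eventually_lt_sub_smul_gradient {E : Type*} [NormedAddCommGroup E] [InnerProductSpace ℝ E]
    [CompleteSpace E] {f : E → ℝ} {x : E} (hf : DifferentiableAt ℝ f x) (hg : gradient f x ≠ 0) :
    ∀ᶠ s : ℝ in nhdsWithin 0 (Set.Ioi 0), f (x - s • gradient f x) < f x := by
  have hline : HasDerivAt (fun s : ℝ => x - s • gradient f x) (-gradient f x) 0 := by
    simpa using ((hasDerivAt_id (0 : ℝ)).smul_const (gradient f x)).const_sub x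
  have hfx : HasFDerivAt f (InnerProductSpace.toDual ℝ E (gradient f x))
      (x - (0 : ℝ) • gradient f x) := by
    simpa using hf.hasGradientAt.hasFDerivAt
  have hderiv := hfx.comp_hasDerivAt (0 : ℝ) hline
  have hneg : (InnerProductSpace.toDual ℝ E (gradient f x)) (-gradient f x) < 0 := by
    rw [InnerProductSpace.toDual_apply_apply, inner_neg_right, real_inner_self_eq_norm_sq]
    have := norm_pos_iff.mpr hg
    linarith [pow_pos this 2]
  have hslope := (hasDerivAt_iff_tendsto_slope.mp hderiv).eventually_lt_const hneg
  have hle : nhdsWithin (0 : ℝ) (Set.Ioi 0) ≤ nhdsWithin 0 {0}ᶜ :=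
    nhdsWithin_mono _ fun s hs => ne_of_gt hs
  filter_upwards [hle hslope, self_mem_nhdsWithin] with s hs hpos
  have hpos : 0 < s := hpos
  simp only [slope_def_field, Function.comp_apply, zero_smul, sub_zero] at hs
  rcases div_neg_iff.mp hs with h | h <;> linarith

/-- If the quadratic upper bound at `x` holds on the sublevel set of `f x`, then a gradient step of
length `1 / β` decreases `f` by at least `‖∇f(x)‖² / (2β)`. -/
theorem gradient_step_descent {E : Type*} [NormedAddCommGroup E] [InnerProductSpace ℝ E]
    [CompleteSpace E] {f : E → ℝ} {β : ℝ} (hβ : 0 < β) (hf : Differentiable ℝ f) {x : E}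
    (hsmooth : ∀ z, f z ≤ f x → f z ≤ f x + ⟪gradient f x, z - x⟫ + β / 2 * ‖z - x‖ ^ 2) :
    f (x - (1 / β) • gradient f x) ≤ f x - ‖gradient f x‖ ^ 2 / (2 * β) := by
  by_cases hg : gradient f x = 0
  · simp [hg]
  have hbound : ∀ s : ℝ, f (x - s • gradient f x) ≤ f x →
      f (x - s • gradient f x) ≤ f x - s * (1 - β * s / 2) * ‖gradient f x‖ ^ 2 := by
    intro s hs
    have h := hsmooth _ hs
    rw [sub_sub_cancel_left, inner_neg_right, real_inner_smul_right, real_inner_self_eq_norm_sq,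
      norm_neg, norm_smul, mul_pow, Real.norm_eq_abs, sq_abs] at h
    linarith
  have hcont : Continuous fun s : ℝ => f (x - s • gradient f x) :=
    hf.continuous.comp (by fun_prop)
  have hsub : Set.Icc 0 (1 / β) ⊆ {s : ℝ | f (x - s • gradient f x) ≤ f x} := by
    refine IsClosed.Icc_subset_of_forall_mem_nhdsWithin
      ((isClosed_le hcont continuous_const).inter isClosed_Icc) (by simp) ?_
    rintro s ⟨hs, hs0, hs1⟩
    rcases hs0.eq_or_lt with rfl | hpos
    · filter_upwards [eventually_lt_sub_smul_gradient (hf x) hg] with s hs using hs.le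
    · have hβs : s * β < 1 := (lt_div_iff₀ hβ).mp hs1
      have hlt : f (x - s • gradient f x) < f x := by
        have hdec : 0 < s * (1 - β * s / 2) * ‖gradient f x‖ ^ 2 :=
          mul_pos (mul_pos hpos (by linarith)) (pow_pos (norm_pos_iff.mpr hg) 2)
        linarith [hbound s hs]
      filter_upwards [nhdsWithin_le_nhds (hcont.continuousAt.eventually_lt_const hlt)]
        with u hu using hu.le
  have h := hbound (1 / β) (hsub ⟨by positivity, le_rfl⟩)
  have heq : 1 / β * (1 - β * (1 / β) / 2) * ‖gradient f x‖ ^ 2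
      = ‖gradient f x‖ ^ 2 / (2 * β) := by
    field_simp
    ring
  rwa [heq] at h

/-- Theorem 1 (SafeRate convergence): under β-smoothness over the initial level
set, SafeRate with the negative gradient direction satisfies
`min_{1 ≤ t ≤ T} ‖∇f(xₜ)‖² ≤ 2β (f(x₁) − f(x_{T+1})) / T`. -/
theorem safeRate_convergence (n : ℕ) (f : EuclideanSpace ℝ (Fin n) → ℝ) (β : ℝ)
    (hβ : 1 ≤ β) (hf : Differentiable ℝ f)
    (x : ℕ → EuclideanSpace ℝ (Fin n)) (ηbar η : ℕ → ℝ)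
    (hsmooth : ∀ y z : EuclideanSpace ℝ (Fin n), f y ≤ f (x 1) → f z ≤ f (x 1) →
      f z ≤ f y + ⟪gradient f y, z - y⟫ + β / 2 * ‖z - y‖ ^ 2)
    (hηbar1 : ηbar 1 = 1)
    (hη : ∀ t, 1 ≤ t → η t = min (1 / β) (ηbar t))
    (hstep : ∀ t, 1 ≤ t → x (t + 1) = x t + η t • (-(gradient f (x t))))
    (hηbar : ∀ t, 1 ≤ t →
      ηbar (t + 1) = if ηbar t / 2 ≤ η t then 2 * ηbar t else ηbar t / 2) :
    ∀ T : ℕ, 1 ≤ T → ∃ t, 1 ≤ t ∧ t ≤ T ∧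
      ‖gradient f (x t)‖ ^ 2 ≤ 2 * β * (f (x 1) - f (x (T + 1))) / T := by
  have hβ0 : 0 < β := by linarith
  have hbar : ∀ t, 1 ≤ t → 1 / β ≤ ηbar t := by
    intro t ht
    induction t, ht using Nat.le_induction with
    | base => rw [hηbar1]; exact (div_le_one hβ0).mpr hβ
    | succ t ht ih =>
      have hpos : 0 < 1 / β := by positivity
      rw [hηbar t ht, hη t ht, min_eq_left ih]
      split_ifs <;> linarith
  have hx : ∀ t, 1 ≤ t → x (t + 1) = x t - (1 / β) • gradient f (x t) := by
    intro t ht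
    rw [hstep t ht, hη t ht, min_eq_left (hbar t ht), smul_neg, sub_eq_add_neg]
  have hdescent : ∀ t, 1 ≤ t → f (x t) ≤ f (x 1) →
      f (x (t + 1)) ≤ f (x t) - ‖gradient f (x t)‖ ^ 2 / (2 * β) := by
    intro t ht hle
    rw [hx t ht]
    exact gradient_step_descent hβ0 hf fun z hz => hsmooth _ _ hle (hz.trans hle)
  have hlevel : ∀ t, 1 ≤ t → f (x t) ≤ f (x 1) := by
    intro t ht
    induction t, ht using Nat.le_induction with
    | base => exact le_rfl
    | succ t ht ih =>
      have : 0 ≤ ‖gradient f (x t)‖ ^ 2 / (2 * β) := by positivity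
      linarith [hdescent t ht ih]
  intro T hT
  have hT0 : (0 : ℝ) < T := by exact_mod_cast hT
  have hsum : ∑ i ∈ Finset.range T, ‖gradient f (x (i + 1))‖ ^ 2
      ≤ ∑ _i ∈ Finset.range T, 2 * β * (f (x 1) - f (x (T + 1))) / T := by
    have hterm : ∀ i ∈ Finset.range T, ‖gradient f (x (i + 1))‖ ^ 2
        ≤ 2 * β * (f (x (i + 1)) - f (x (i + 1 + 1))) := by
      intro i _
      have h := hdescent (i + 1) (by omega) (hlevel _ (by omega))
      rw [mul_comm, ← div_le_iff₀ (by positivity)]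
      linarith
    refine (Finset.sum_le_sum hterm).trans_eq ?_
    rw [← Finset.mul_sum, Finset.sum_range_sub' (fun i => f (x (i + 1))), Finset.sum_const,
      Finset.card_range, nsmul_eq_mul]
    field_simp
  obtain ⟨i, hi, hle⟩ := Finset.exists_le_of_sum_le (Finset.nonempty_range_iff.mpr (by omega)) hsum
  exact ⟨i + 1, by omega, Finset.mem_range.mp hi, hle⟩
end

section
/- For all real x and y, log(1 + exp(x)) ≤ log(1 + exp(y)) + (exp(y)/(1 + exp(y)))·(x − y) + (1/8)·(x − y)². -/
/-- A convex function on `ℝ` lies above each of its tangent lines. -/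
theorem ConvexOn.tangent_line_le {f : ℝ → ℝ} (hf : ConvexOn ℝ Set.univ f) {f' y : ℝ}
    (hy : HasDerivAt f f' y) (x : ℝ) : f y + f' * (x - y) ≤ f x := by
  rcases lt_trichotomy x y with h | rfl | h
  · have := hf.slope_le_of_hasDerivAt (Set.mem_univ x) (Set.mem_univ y) h hy
    rw [slope_def_field, div_le_iff₀ (sub_pos.2 h)] at this
    linarith
  · simp
  · have := hf.le_slope_of_hasDerivAt (Set.mem_univ y) (Set.mem_univ x) h hy
    rw [slope_def_field, le_div_iff₀ (sub_pos.2 h)] at this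
    linarith

theorem Real.sigmoid_eq_exp_div (x : ℝ) :
    Real.sigmoid x = Real.exp x / (1 + Real.exp x) := by
  rw [Real.sigmoid_def, Real.exp_neg]
  field_simp
  ring

theorem hasDerivAt_log_one_add_exp (x : ℝ) :
    HasDerivAt (fun t => Real.log (1 + Real.exp t)) (Real.sigmoid x) x := by
  rw [Real.sigmoid_eq_exp_div]
  exact ((Real.hasDerivAt_exp x).const_add 1).log (by positivity)

theorem monotone_div_four_sub_sigmoid : Monotone fun x : ℝ => x / 4 - Real.sigmoid x := by
  refine monotone_of_hasDerivAt_nonneg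
    (fun x => ((hasDerivAt_id x).div_const 4).sub (Real.hasDerivAt_sigmoid x)) fun x => ?_
  simp only [Pi.zero_apply]
  nlinarith [sq_nonneg (Real.sigmoid x - 1 / 2)]

theorem hasDerivAt_sq_div_eight_sub_softplus (x : ℝ) :
    HasDerivAt (fun t => t ^ 2 / 8 - Real.log (1 + Real.exp t)) (x / 4 - Real.sigmoid x) x := by
  refine (((hasDerivAt_pow 2 x).div_const 8).sub (hasDerivAt_log_one_add_exp x)).congr_deriv ?_
  norm_num
  ring

theorem convexOn_sq_div_eight_sub_softplus :
    ConvexOn ℝ Set.univ fun t : ℝ => t ^ 2 / 8 - Real.log (1 + Real.exp t) := by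
  refine Monotone.convexOn_univ_of_deriv
    (fun x => (hasDerivAt_sq_div_eight_sub_softplus x).differentiableAt) ?_
  rw [funext fun x => (hasDerivAt_sq_div_eight_sub_softplus x).deriv]
  exact monotone_div_four_sub_sigmoid

/-- Quadratic majorizer of the softplus function:
`log(1 + eˣ) ≤ log(1 + eʸ) + σ(y)(x − y) + (1/8)(x − y)²`. -/
theorem softplus_quadratic_majorizer (x y : ℝ) :
    Real.log (1 + Real.exp x) ≤
      Real.log (1 + Real.exp y) + Real.exp y / (1 + Real.exp y) * (x - y) +
        1 / 8 * (x - y) ^ 2 := by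
  have h := convexOn_sq_div_eight_sub_softplus.tangent_line_le
    (hasDerivAt_sq_div_eight_sub_softplus y) x
  rw [← Real.sigmoid_eq_exp_div]
  linarith
end

section
/- Let A ∈ ℝ^{d×d} be symmetric, b ∈ ℝᵈ, f(x) = (1/2)xᵀAx − bᵀx, and let x̲ ≤ 0 ≤ x̄ (componentwise) define a hyperrectangle [x̲, x̄] ⊆ ℝᵈ. Let p₁, …, p_d be pairwise conjugate with respect to A. Define x₀ = 0 and, for i = 1, …, d, x_i = x_{i−1} + α_i p_i, where α_i minimizes α ↦ f(α p_i) over the set S_i = {α ∈ ℝ : x_{i−1} + α p_i ∈ [x̲, x̄]} (assume each S_i is nonempty, contains 0, and the minimum is attained). Then f(x_d) ≤ f(x_{d−1}) ≤ … ≤ f(x₁) ≤ 0. -/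
open Matrix

/-- Along two vectors that are conjugate with respect to a symmetric matrix, a quadratic objective
is additive. -/
lemma quadratic_add_of_conjugate {n : Type*} [Fintype n] {A : Matrix n n ℝ} (hA : A.IsSymm)
    (b : n → ℝ) {u v : n → ℝ} (huv : u ⬝ᵥ A *ᵥ v = 0) :
    1 / 2 * ((u + v) ⬝ᵥ A *ᵥ (u + v)) - b ⬝ᵥ (u + v) =
      (1 / 2 * (u ⬝ᵥ A *ᵥ u) - b ⬝ᵥ u) + (1 / 2 * (v ⬝ᵥ A *ᵥ v) - b ⬝ᵥ v) := by
  have hvu : v ⬝ᵥ A *ᵥ u = 0 := by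
    rw [dotProduct_mulVec, ← mulVec_transpose, hA.eq, dotProduct_comm, huv]
  simp only [mulVec_add, add_dotProduct, dotProduct_add, huv, hvu]
  ring

/-- Iterates started at the origin and moved along pairwise conjugate directions are conjugate to
all later directions. -/
lemma iterate_conjugate_of_lt {n : Type*} [Fintype n] {A : Matrix n n ℝ} {d : ℕ}
    {p x : ℕ → n → ℝ} {α : ℕ → ℝ}
    (hconj : ∀ i j, 1 ≤ i → i ≤ d → 1 ≤ j → j ≤ d → i ≠ j → p i ⬝ᵥ A *ᵥ p j = 0)
    (hx0 : x 0 = 0) (hstep : ∀ i, 1 ≤ i → i ≤ d → x i = x (i - 1) + α i • p i)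
    {k i : ℕ} (hki : k < i) (hid : i ≤ d) : x k ⬝ᵥ A *ᵥ p i = 0 := by
  induction k with
  | zero => simp [hx0]
  | succ k ih =>
    rw [hstep (k + 1) (by omega) (by omega), Nat.add_sub_cancel, add_dotProduct, smul_dotProduct,
      ih (by omega), hconj (k + 1) i (by omega) (by omega) (by omega) hid (by omega),
      smul_zero, add_zero]

/-- Constrained conjugate-direction descent over a hyperrectangle monotonically
decreases the quadratic objective: `f(x_d) ≤ f(x_{d−1}) ≤ … ≤ f(x₁) ≤ 0`. -/
theorem constrained_cg_monotone (d : ℕ)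
    (A : Matrix (Fin d) (Fin d) ℝ) (hA : A.IsSymm) (b : Fin d → ℝ)
    (f : (Fin d → ℝ) → ℝ)
    (hf : ∀ x, f x = 1 / 2 * (x ⬝ᵥ A.mulVec x) - b ⬝ᵥ x)
    (lo hi : Fin d → ℝ) (hlo : ∀ j, lo j ≤ 0) (hhi : ∀ j, 0 ≤ hi j)
    (p : ℕ → (Fin d → ℝ))
    (hconj : ∀ i j, 1 ≤ i → i ≤ d → 1 ≤ j → j ≤ d → i ≠ j →
      p i ⬝ᵥ A.mulVec (p j) = 0)
    (x : ℕ → (Fin d → ℝ)) (α : ℕ → ℝ)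
    (hx0 : x 0 = 0)
    (hstep : ∀ i, 1 ≤ i → i ≤ d → x i = x (i - 1) + α i • p i)
    (hzero_feas : ∀ i, 1 ≤ i → i ≤ d →
      ∀ j, lo j ≤ x (i - 1) j ∧ x (i - 1) j ≤ hi j)
    (hfeas : ∀ i, 1 ≤ i → i ≤ d →
      ∀ j, lo j ≤ (x (i - 1) + α i • p i) j ∧ (x (i - 1) + α i • p i) j ≤ hi j)
    (hmin : ∀ i, 1 ≤ i → i ≤ d → ∀ a : ℝ,
      (∀ j, lo j ≤ (x (i - 1) + a • p i) j ∧ (x (i - 1) + a • p i) j ≤ hi j) →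
      f (α i • p i) ≤ f (a • p i)) :
    ∀ i, 1 ≤ i → i ≤ d → f (x i) ≤ f (x (i - 1)) ∧ f (x i) ≤ 0 := by
  have hf0 : f 0 = 0 := by simp [hf]
  have hdesc : ∀ i, 1 ≤ i → i ≤ d → f (x i) ≤ f (x (i - 1)) := by
    intro i h1 hid
    have hterm : f (α i • p i) ≤ 0 := by
      simpa [hf0] using hmin i h1 hid 0 (by simpa using hzero_feas i h1 hid)
    have horth : x (i - 1) ⬝ᵥ A *ᵥ (α i • p i) = 0 := by
      rw [mulVec_smul, dotProduct_smul,
        iterate_conjugate_of_lt hconj hx0 hstep (by omega) hid, smul_zero]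
    have hadd : f (x i) = f (x (i - 1)) + f (α i • p i) := by
      rw [hstep i h1 hid, hf, hf (x (i - 1)), hf (α i • p i)]
      exact quadratic_add_of_conjugate hA b horth
    linarith
  have hnonpos : ∀ i, i ≤ d → f (x i) ≤ 0 := by
    intro i
    induction i with
    | zero => intro _; rw [hx0, hf0]
    | succ k ih =>
      intro hk
      exact (hdesc (k + 1) (by omega) hk).trans (ih (by omega))
  exact fun i h1 hid => ⟨hdesc i h1 hid, hnonpos i hid⟩
end

section
/- Let A ∈ ℝ^{d×d} be symmetric positive definite, b ∈ ℝᵈ, f(x) = (1/2)xᵀAx − bᵀx, and let [x̲, x̄] ⊆ ℝᵈ be a hyperrectangle with x̲ ≤ 0 ≤ x̄. Let p₁, …, p_d be nonzero and pairwise conjugate with respect to A. Define x₀ = 0 and x_i = x_{i−1} + α_i p_i, where α_i minimizes α ↦ f(α p_i) over S_i = {α : x_{i−1} + α p_i ∈ [x̲, x̄]}. If every x_i lies in the interior of [x̲, x̄], then x_d is the global minimizer of f over ℝᵈ; in particular x_d = argmin_{x ∈ [x̲, x̄]} f(x). -/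
open Matrix

/-- A local minimizer of `a ↦ 1/2 a² c - a β` is a stationary point. -/
lemma stationary_of_isLocalMin_quadratic {c β t : ℝ}
    (h : IsLocalMin (fun a : ℝ => 1 / 2 * (a ^ 2 * c) - a * β) t) : t * c = β := by
  have hd : HasDerivAt (fun a : ℝ => 1 / 2 * (a ^ 2 * c) - a * β) (t * c - β) t := by
    have h1 := ((((hasDerivAt_id t).pow 2).mul_const c).const_mul (1 / 2)).sub
      ((hasDerivAt_id t).mul_const β)
    refine h1.congr_deriv ?_
    simp only [id]
    ring
  linarith [h.hasDerivAt_eq_zero hd]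

/-- Nonzero vectors pairwise conjugate with respect to a positive definite matrix are
linearly independent. -/
lemma linearIndependent_of_conjugate {ι n : Type*} [Fintype n] {A : Matrix n n ℝ}
    (hA : A.PosDef) {v : ι → n → ℝ} (hv : ∀ i, v i ≠ 0)
    (hconj : ∀ i j, i ≠ j → v i ⬝ᵥ A *ᵥ v j = 0) : LinearIndependent ℝ v := by
  rw [linearIndependent_iff']
  intro s g hg i hi
  have h : v i ⬝ᵥ A *ᵥ (∑ j ∈ s, g j • v j) = 0 := by simp [hg]
  rw [mulVec_sum, dotProduct_sum, Finset.sum_eq_single i] at h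
  · have hpos : 0 < v i ⬝ᵥ A *ᵥ v i := by simpa using hA.dotProduct_mulVec_pos (hv i)
    rw [mulVec_smul, dotProduct_smul, smul_eq_mul] at h
    exact (mul_eq_zero.mp h).resolve_right hpos.ne'
  · intro j _ hj
    rw [mulVec_smul, dotProduct_smul, hconj i j hj.symm, smul_zero]
  · exact fun h => absurd hi h

/-- A stationary point of a convex quadratic function is a global minimizer. -/
lemma quadratic_le_of_mulVec_eq {n : Type*} [Fintype n] {A : Matrix n n ℝ}
    (hA : A.PosSemidef) {b x : n → ℝ} (hx : A *ᵥ x = b) (y : n → ℝ) :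
    1 / 2 * (x ⬝ᵥ A *ᵥ x) - b ⬝ᵥ x ≤ 1 / 2 * (y ⬝ᵥ A *ᵥ y) - b ⬝ᵥ y := by
  have hnn : 0 ≤ (y - x) ⬝ᵥ A *ᵥ (y - x) := by
    simpa using hA.dotProduct_mulVec_nonneg (y - x)
  have hsymm : x ⬝ᵥ A *ᵥ y = b ⬝ᵥ y := by
    have hT : Aᵀ = A := by simpa [IsHermitian, conjTranspose_eq_transpose_of_trivial] using hA.1
    rw [dotProduct_mulVec, ← mulVec_transpose, hT, hx]
  simp only [mulVec_sub, dotProduct_sub, sub_dotProduct, hx] at hnn ⊢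
  rw [hsymm] at hnn
  rw [dotProduct_comm x b] at hnn ⊢
  rw [dotProduct_comm y b] at hnn
  linarith

/-- If `A` is positive definite and every iterate of the constrained
conjugate-direction method lies in the interior of the hyperrectangle, then the
final iterate `x_d` is a global minimizer of `f` over all of `ℝᵈ` (and hence
over the hyperrectangle). -/
theorem constrained_cg_interior_global_min (d : ℕ)
    (A : Matrix (Fin d) (Fin d) ℝ) (hA : A.PosDef) (b : Fin d → ℝ)
    (f : (Fin d → ℝ) → ℝ)
    (hf : ∀ x, f x = 1 / 2 * (x ⬝ᵥ A.mulVec x) - b ⬝ᵥ x)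
    (lo hi : Fin d → ℝ) (hlo : ∀ j, lo j ≤ 0) (hhi : ∀ j, 0 ≤ hi j)
    (p : ℕ → (Fin d → ℝ))
    (hp_ne : ∀ i, 1 ≤ i → i ≤ d → p i ≠ 0)
    (hconj : ∀ i j, 1 ≤ i → i ≤ d → 1 ≤ j → j ≤ d → i ≠ j →
      p i ⬝ᵥ A.mulVec (p j) = 0)
    (x : ℕ → (Fin d → ℝ)) (α : ℕ → ℝ)
    (hx0 : x 0 = 0)
    (hstep : ∀ i, 1 ≤ i → i ≤ d → x i = x (i - 1) + α i • p i)
    (hmin : ∀ i, 1 ≤ i → i ≤ d → ∀ a : ℝ,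
      (∀ j, lo j ≤ (x (i - 1) + a • p i) j ∧ (x (i - 1) + a • p i) j ≤ hi j) →
      f (α i • p i) ≤ f (a • p i))
    (hinterior : ∀ i, 1 ≤ i → i ≤ d → ∀ j, lo j < x i j ∧ x i j < hi j) :
    ∀ y : Fin d → ℝ, f (x d) ≤ f y := by
  have hα : ∀ i, 1 ≤ i → i ≤ d → α i * (p i ⬝ᵥ A *ᵥ p i) = b ⬝ᵥ p i := by
    intro i h1 hd
    apply stationary_of_isLocalMin_quadratic
    have hcoord : ∀ j, ∀ᶠ a in nhds (α i), lo j ≤ (x (i - 1) + a • p i) j ∧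
        (x (i - 1) + a • p i) j ≤ hi j := by
      intro j
      have hc : ContinuousAt (fun a : ℝ => (x (i - 1) + a • p i) j) (α i) := by
        simp only [Pi.add_apply, Pi.smul_apply, smul_eq_mul]
        fun_prop
      have hj := hinterior i h1 hd j
      rw [hstep i h1 hd] at hj
      exact (hc.eventually_const_lt hj.1).and (hc.eventually_lt_const hj.2) |>.mono
        fun a ha => ⟨ha.1.le, ha.2.le⟩
    filter_upwards [Filter.eventually_all.mpr hcoord] with a ha
    have h := hmin i h1 hd a ha
    simp only [hf, mulVec_smul, dotProduct_smul, smul_dotProduct, smul_eq_mul] at h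
    linarith
  have hx : ∀ k ≤ d, ∀ i, 1 ≤ i → i ≤ d →
      p i ⬝ᵥ A *ᵥ x k = if i ≤ k then α i * (p i ⬝ᵥ A *ᵥ p i) else 0 := by
    intro k
    induction k with
    | zero =>
      intro _ i h1 _
      rw [hx0, if_neg (by omega)]
      simp
    | succ k ih =>
      intro hk i h1 hd
      rw [hstep (k + 1) (by omega) hk, Nat.add_sub_cancel, mulVec_add, dotProduct_add,
        mulVec_smul, dotProduct_smul, smul_eq_mul, ih (by omega) i h1 hd]
      by_cases hik : i = k + 1
      · subst hik
        simp
      · rw [hconj i (k + 1) h1 hd (by omega) hk hik]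
        have : i ≤ k ↔ i ≤ k + 1 := by omega
        simp [this]
  have hli : LinearIndependent ℝ fun i : Fin d => p (i + 1) :=
    linearIndependent_of_conjugate hA (fun i => hp_ne _ (by omega) (by omega))
      fun i j hij => hconj _ _ (by omega) (by omega) (by omega) (by omega) (by omega)
  have hspan := hli.span_eq_top_of_card_eq_finrank' (by simp)
  have horth : ∀ v : Fin d → ℝ, v ⬝ᵥ (A *ᵥ x d - b) = 0 := by
    intro v
    have hv : v ∈ Submodule.span ℝ (Set.range fun i : Fin d => p (i + 1)) := by
      rw [hspan]
      exact Submodule.mem_top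
    induction hv using Submodule.span_induction with
    | mem v hv =>
      obtain ⟨i, rfl⟩ := hv
      have hid : (i : ℕ) + 1 ≤ d := by omega
      simp only
      rw [dotProduct_sub, hx d le_rfl _ (by omega) hid, if_pos hid, hα _ (by omega) hid,
        dotProduct_comm b, sub_self]
    | zero => simp
    | add v w _ _ hv hw => rw [add_dotProduct, hv, hw, add_zero]
    | smul a v _ hv => rw [smul_dotProduct, hv, smul_zero]
  intro y
  rw [hf, hf]
  exact quadratic_le_of_mulVec_eq hA.posSemidef
    (sub_eq_zero.mp (dotProduct_self_eq_zero.mp (horth _))) y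
end
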